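/- For all integers K ≥ 1 and L ≥ 1, the normalizer of the MDL prior over admissible dictionaries satisfies Z := Σ_{C ∈ 𝒜} 2^{−L_dict(C)} ≤ 1. -/

import Mathlib

open Finset

/-- The finite set of all phrases over `Σ = Fin K`: nonempty lists of length at most `L`. -/
def phrases (K L : ℕ) : Finset (List (Fin K)) :=
  ((Finset.range (L + 1)).biUnion fun ℓ =>
    (Finset.univ : Finset (Fin ℓ → Fin K)).image List.ofFn).filter fun p => p ≠ []

/-- The set `𝒜` of admissible dictionaries: subsets of the set of phrases containing
all `K` singleton phrases. -/
def admissible (K L : ℕ) : Finset (Finset (List (Fin K))) :=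
  (phrases K L).powerset.filter fun C => ∀ a : Fin K, [a] ∈ C

/-- The dictionary cost `L_dict(C) = Σ_{p ∈ C} (|p|·log₂ K + log₂ L)`. -/
noncomputable def Ldict (K L : ℕ) (C : Finset (List (Fin K))) : ℝ :=
  ∑ p ∈ C, ((p.length : ℝ) * Real.logb 2 (K : ℝ) + Real.logb 2 (L : ℝ))

/-- The normalizer `Z = Σ_{C ∈ 𝒜} 2^{−L_dict(C)}` of the MDL prior. -/
noncomputable def Zval (K L : ℕ) : ℝ :=
  ∑ C ∈ admissible K L, (2 : ℝ) ^ (-(Ldict K L C))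

/-- The weight `2^{-(|p| log₂ K + log₂ L)} = K^{-|p|} / L` of a single phrase. -/
noncomputable def phraseWeight (K L : ℕ) (p : List (Fin K)) : ℝ :=
  ((K : ℝ) ^ p.length * (L : ℝ))⁻¹

/-- The finite set of singleton phrases. -/
def singletonPhrases (K : ℕ) : Finset (List (Fin K)) :=
  (Finset.univ : Finset (Fin K)).image fun a => [a]

theorem mem_phrases {K L : ℕ} {p : List (Fin K)} :
    p ∈ phrases K L ↔ p.length ≤ L ∧ p ≠ [] := by
  simp only [phrases, mem_filter, mem_biUnion, mem_range, mem_image, mem_univ, true_and,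
    Nat.lt_succ_iff]
  refine and_congr_left fun _ => ⟨?_, fun h => ⟨p.length, h, p.get, List.ofFn_get p⟩⟩
  rintro ⟨ℓ, hℓ, f, rfl⟩
  simpa using hℓ

theorem singletonPhrases_subset {K L : ℕ} (hL : 1 ≤ L) :
    singletonPhrases K ⊆ phrases K L := by
  intro p hp
  obtain ⟨a, -, rfl⟩ := mem_image.1 hp
  exact mem_phrases.2 ⟨by simpa using hL, by simp⟩

theorem admissible_eq_Icc (K L : ℕ) :
    admissible K L = Finset.Icc (singletonPhrases K) (phrases K L) := by
  ext C
  simp [admissible, singletonPhrases, Finset.subset_iff, and_comm]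

theorem two_rpow_neg_Ldict {K L : ℕ} (hK : 1 ≤ K) (hL : 1 ≤ L) (C : Finset (List (Fin K))) :
    (2 : ℝ) ^ (-(Ldict K L C)) = ∏ p ∈ C, phraseWeight K L p := by
  have hK' : (0 : ℝ) < K := by exact_mod_cast hK
  have hL' : (0 : ℝ) < L := by exact_mod_cast hL
  rw [Ldict, ← Finset.sum_neg_distrib, Real.rpow_sum_of_pos two_pos]
  refine Finset.prod_congr rfl fun p _ => ?_
  rw [phraseWeight, Real.rpow_neg two_pos.le, Real.rpow_add two_pos, mul_comm (p.length : ℝ),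
    Real.rpow_mul two_pos.le, Real.rpow_logb two_pos (by norm_num) hK',
    Real.rpow_logb two_pos (by norm_num) hL', Real.rpow_natCast]

theorem phraseWeight_nonneg (K L : ℕ) (p : List (Fin K)) : 0 ≤ phraseWeight K L p := by
  unfold phraseWeight
  positivity

theorem card_filter_length_le (K ℓ : ℕ) (s : Finset (List (Fin K))) :
    (s.filter fun p => p.length = ℓ).card ≤ K ^ ℓ := by
  calc (s.filter fun p => p.length = ℓ).card
      ≤ ((Finset.univ : Finset (Fin ℓ → Fin K)).image List.ofFn).card := by
        refine card_le_card fun p hp => ?_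
        obtain ⟨-, rfl⟩ := mem_filter.1 hp
        exact mem_image.2 ⟨p.get, mem_univ _, List.ofFn_get p⟩
    _ ≤ K ^ ℓ := by simpa using
        card_image_le (s := (Finset.univ : Finset (Fin ℓ → Fin K))) (f := List.ofFn)

/-- The phrases of length at least two have total weight at most `1 - 1 / L`. -/
theorem sum_phraseWeight_sdiff_le {K L : ℕ} (hK : 1 ≤ K) (hL : 1 ≤ L) :
    ∑ p ∈ phrases K L \ singletonPhrases K, phraseWeight K L p ≤ 1 - (L : ℝ)⁻¹ := by
  have hK' : (0 : ℝ) < K := by exact_mod_cast hK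
  have hL' : (0 : ℝ) < L := by exact_mod_cast hL
  have hmaps : ∀ p ∈ phrases K L \ singletonPhrases K, p.length ∈ Finset.Icc 2 L := by
    intro p hp
    obtain ⟨hp, hs⟩ := mem_sdiff.1 hp
    obtain ⟨hlen, hne⟩ := mem_phrases.1 hp
    have h_one : p.length ≠ 1 := fun h => by
      obtain ⟨a, rfl⟩ := List.length_eq_one_iff.1 h
      exact hs (mem_image.2 ⟨a, mem_univ _, rfl⟩)
    have h_pos := List.length_pos_iff.2 hne
    exact mem_Icc.2 ⟨by omega, hlen⟩
  rw [← Finset.sum_fiberwise_of_maps_to hmaps]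
  calc _ ≤ ∑ _ℓ ∈ Finset.Icc 2 L, (L : ℝ)⁻¹ := by
        refine Finset.sum_le_sum fun ℓ _ => ?_
        rw [Finset.sum_congr rfl (g := fun _ => ((K : ℝ) ^ ℓ * (L : ℝ))⁻¹)
          (fun p hp => by rw [phraseWeight, (mem_filter.1 hp).2]), sum_const, nsmul_eq_mul,
          mul_inv, ← mul_assoc]
        refine mul_le_of_le_one_left (by positivity) ?_
        rw [← div_eq_mul_inv, div_le_one (by positivity)]
        exact_mod_cast card_filter_length_le K ℓ _
    _ = 1 - (L : ℝ)⁻¹ := by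
        have hcard : L + 1 - 2 = L - 1 := by omega
        rw [sum_const, Nat.card_Icc, nsmul_eq_mul, hcard, Nat.cast_sub hL]
        field_simp
        simp

theorem prod_phraseWeight_singletonPhrases_le {K L : ℕ} (hK : 1 ≤ K) (hL : 1 ≤ L) :
    ∏ p ∈ singletonPhrases K, phraseWeight K L p ≤ (L : ℝ)⁻¹ := by
  have hK' : (1 : ℝ) ≤ K := by exact_mod_cast hK
  have hL' : (1 : ℝ) ≤ L := by exact_mod_cast hL
  rw [singletonPhrases, Finset.prod_image (by simp [Set.InjOn])]
  simp only [phraseWeight, List.length_singleton, pow_one, prod_const, card_univ,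
    Fintype.card_fin, inv_pow]
  refine inv_anti₀ (by positivity) ?_
  calc (L : ℝ) ≤ K * L := le_mul_of_one_le_left (by positivity) hK'
    _ ≤ (K * L) ^ K := le_self_pow₀ (one_le_mul_of_one_le_of_one_le hK' hL') (by omega)

theorem Zval_eq_prod {K L : ℕ} (hK : 1 ≤ K) (hL : 1 ≤ L) :
    Zval K L = (∏ p ∈ singletonPhrases K, phraseWeight K L p) *
      ∏ p ∈ phrases K L \ singletonPhrases K, (1 + phraseWeight K L p) := by
  have hdisj : ∀ D ∈ (phrases K L \ singletonPhrases K).powerset,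
      Disjoint (singletonPhrases K) D := fun D hD =>
    disjoint_sdiff.mono_right (mem_powerset.1 hD)
  have hinj : Set.InjOn (singletonPhrases K ∪ ·)
      ((phrases K L \ singletonPhrases K).powerset : Set (Finset (List (Fin K)))) := by
    intro D hD E hE h
    rw [← union_sdiff_cancel_left (hdisj D hD), ← union_sdiff_cancel_left (hdisj E hE)]
    exact congrArg (· \ singletonPhrases K) h
  rw [Zval, admissible_eq_Icc, Finset.Icc_eq_image_powerset (singletonPhrases_subset hL),
    Finset.sum_image hinj, Finset.prod_one_add, Finset.mul_sum]
  refine Finset.sum_congr rfl fun D hD => ?_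
  rw [two_rpow_neg_Ldict hK hL, Finset.prod_union (hdisj D hD)]

/-- For all integers `K ≥ 1` and `L ≥ 1`, the normalizer of the MDL
prior over admissible dictionaries satisfies `Z = Σ_{C ∈ 𝒜} 2^{−L_dict(C)} ≤ 1`. -/
theorem Zval_le_one (K L : ℕ) (hK : 1 ≤ K) (hL : 1 ≤ L) : Zval K L ≤ 1 := by
  have hL' : (0 : ℝ) < L := by exact_mod_cast hL
  have hprod : ∏ p ∈ phrases K L \ singletonPhrases K, (1 + phraseWeight K L p) ≤ L :=
    calc _ ≤ ∏ p ∈ phrases K L \ singletonPhrases K, Real.exp (phraseWeight K L p) :=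
          Finset.prod_le_prod (fun p _ => add_nonneg zero_le_one (phraseWeight_nonneg K L p))
            fun p _ => by rw [add_comm]; exact Real.add_one_le_exp _
      _ = Real.exp (∑ p ∈ phrases K L \ singletonPhrases K, phraseWeight K L p) :=
          (Real.exp_sum _ _).symm
      _ ≤ Real.exp (Real.log L) := Real.exp_le_exp.2
          ((sum_phraseWeight_sdiff_le hK hL).trans (Real.one_sub_inv_le_log_of_pos hL'))
      _ = L := Real.exp_log hL'
  calc Zval K L = _ := Zval_eq_prod hK hL
    _ ≤ (L : ℝ)⁻¹ * L := mul_le_mul (prod_phraseWeight_singletonPhrases_le hK hL) hprod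
        (Finset.prod_nonneg fun p _ => add_nonneg zero_le_one (phraseWeight_nonneg K L p))
        (by positivity)
    _ = 1 := inv_mul_cancel₀ hL'.ne'
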